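/- For any M, N ≥ 2 and p ≥ 1: δ_p(M,N) ≤ 1 − (1 − 1/M^{p−1})(1 − 1/N^{p−1})(1 − ε_p(2,2)), where ε_p(2,2) is the fraction of pairs (π,σ) of partitions of {1,...,p} with exactly 2 blocks each satisfying π ▷ σ. -/

import Mathlib

/-- cyclic successor on `Fin p` -/
def cyc (p : ℕ) (y : Fin p) : Fin p := ⟨((y : ℕ) + 1) % p, Nat.mod_lt _ y.pos⟩

/-- `δ_p(M,N)` -/
noncomputable def delta (M N p : ℕ) : ℝ :=
  (Nat.card {ab : (Fin p → ZMod M) × (Fin p → ZMod N) //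
    (Finset.univ.val.map fun y => (ab.1 y, ab.2 y)) =
    (Finset.univ.val.map fun y => (ab.1 y, ab.2 (cyc p y)))} : ℝ) / ((M : ℝ) * N) ^ p

/-- cyclic predecessor on `Fin p` -/
def cycPred (p : ℕ) (y : Fin p) : Fin p := ⟨((y : ℕ) + p - 1) % p, Nat.mod_lt _ y.pos⟩

/-- the compatibility condition `π ▷ σ` -/
def tri (p : ℕ) (π σ : Finpartition (Finset.univ : Finset (Fin p))) : Prop :=
  ∀ β ∈ π.parts, ∀ γ ∈ σ.parts, (β ∩ γ).card = (β.image (cycPred p) ∩ γ).card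

instance (p : ℕ) (π σ : Finpartition (Finset.univ : Finset (Fin p))) :
    Decidable (tri p π σ) := by unfold tri; infer_instance

/-- the Stirling number `S_{ps}`: the number of partitions of `{1,...,p}` with `s` blocks -/
def Spart (p s : ℕ) : ℕ :=
  (Finset.univ.filter
    (fun π : Finpartition (Finset.univ : Finset (Fin p)) => π.parts.card = s)).card

/-- `ε_p(s,t) = P(π ▷ σ | |π| = s, |σ| = t)` -/
noncomputable def eps (p s t : ℕ) : ℝ :=
  ((Finset.univ.filter
    (fun πσ : Finpartition (Finset.univ : Finset (Fin p)) ×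
        Finpartition (Finset.univ : Finset (Fin p)) =>
      πσ.1.parts.card = s ∧ πσ.2.parts.card = t ∧ tri p πσ.1 πσ.2)).card : ℝ) /
    ((Spart p s : ℝ) * Spart p t)

namespace S13
open Finset Classical

noncomputable def Wt {γ : Type*} [Fintype γ] (x : γ → ℝ) (k : ℕ) : ℝ :=
  ∑ c ∈ piAntidiag (univ : Finset γ) k, ((Nat.multinomial univ c : ℝ) * ∏ z, x z ^ c z) ^ 2

noncomputable def cnt {ι γ : Type*} [Fintype ι] (u : ι → γ) (z : γ) : ℕ := #{t | u t = z}

lemma prod_cnt {ι γ : Type*} [Fintype ι] [Fintype γ] (u : ι → γ) (x : γ → ℝ) :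
    ∏ t, x (u t) = ∏ z, x z ^ cnt u z := by
  rw [← Finset.prod_fiberwise (s := univ) (g := u)]
  refine Finset.prod_congr rfl fun z _ => ?_
  rw [Finset.prod_congr rfl (g := fun _ => x z)]
  · simp [cnt]
  · intro t ht; simp at ht; rw [ht]

lemma sum_cnt {ι γ : Type*} [Fintype ι] [Fintype γ] (u : ι → γ) :
    ∑ z, cnt u z = Fintype.card ι := by
  have h := Finset.card_eq_sum_card_fiberwise (f := u) (s := univ) (t := univ) (by simp)
  rw [Finset.card_univ] at h
  rw [h]
  unfold cnt
  refine Finset.sum_congr rfl fun z _ => ?_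
  congr

lemma card_cnt {ι γ : Type*} [Fintype ι] [DecidableEq ι] [Fintype γ] (c : γ → ℕ)
    (hc : ∑ z, c z = Fintype.card ι) :
    #{u : ι → γ | cnt u = c} = Nat.multinomial univ c := by
  have h1 : (∑ z, (MvPolynomial.X z : MvPolynomial γ ℕ)) ^ (Fintype.card ι)
      = ∑ u : ι → γ, ∏ t, MvPolynomial.X (u t) := by
    have := Finset.prod_univ_sum (fun _ : ι => (univ : Finset γ))
      (fun _ z => (MvPolynomial.X z : MvPolynomial γ ℕ))
    simp at this
    exact this
  have h2 := Finset.sum_pow_eq_sum_piAntidiag univ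
    (fun z => (MvPolynomial.X z : MvPolynomial γ ℕ)) (Fintype.card ι)
  have h3 : ∀ d : γ → ℕ, (∏ z, (MvPolynomial.X z : MvPolynomial γ ℕ) ^ d z)
      = MvPolynomial.monomial (Finsupp.equivFunOnFinite.symm d) 1 := by
    intro d
    rw [MvPolynomial.monomial_eq]
    simp [Finsupp.prod_fintype]
  have h4 : ∀ u : ι → γ, (∏ t, (MvPolynomial.X (u t) : MvPolynomial γ ℕ))
      = MvPolynomial.monomial (Finsupp.equivFunOnFinite.symm (cnt u)) 1 := by
    intro u
    rw [← h3, ← Finset.prod_fiberwise (s := univ) (g := u)]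
    refine Finset.prod_congr rfl fun z _ => ?_
    rw [Finset.prod_congr rfl (g := fun _ => (MvPolynomial.X z : MvPolynomial γ ℕ))]
    · simp [cnt]
    · intro t ht; simp at ht; rw [ht]
  rw [h1] at h2
  have h5 := congrArg (MvPolynomial.coeff (Finsupp.equivFunOnFinite.symm c)) h2
  simp only [h3, h4, MvPolynomial.coeff_sum, MvPolynomial.coeff_monomial,
    EmbeddingLike.apply_eq_iff_eq, Finset.sum_boole] at h5
  simp only [← MvPolynomial.C_eq_coe_nat, MvPolynomial.coeff_C_mul, MvPolynomial.coeff_monomial,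
    EmbeddingLike.apply_eq_iff_eq] at h5
  simpa [hc] using h5

lemma pair_sum {ι ι' γ : Type*} [Fintype ι] [DecidableEq ι] [Fintype ι'] [DecidableEq ι'] [Fintype γ] (x : γ → ℝ) (k : ℕ)
    (h : Fintype.card ι = k) (h' : Fintype.card ι' = k) :
    ∑ u : ι → γ, ∑ v : ι' → γ,
      (if cnt u = cnt v then (∏ t, x (u t)) * (∏ t, x (v t)) else 0) = Wt x k := by
  have key : ∀ (κ : Type _) [Fintype κ] [DecidableEq κ] (hk : Fintype.card κ = k) (c : γ → ℕ)
      (hc : c ∈ piAntidiag (univ : Finset γ) k),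
      ∑ u : κ → γ, (if cnt u = c then ∏ t, x (u t) else 0) =
        (Nat.multinomial univ c : ℝ) * ∏ z, x z ^ c z := by
    intro κ _ _ hk c hc
    simp at hc
    rw [← card_cnt (ι := κ) c (by rw [hc, hk]), ← Finset.sum_filter,
      Finset.sum_congr rfl (g := fun _ => ∏ z, x z ^ c z)]
    · simp
    · intro u hu; simp at hu; rw [prod_cnt, hu]
  have key' : ∀ (κ : Type _) [Fintype κ] [DecidableEq κ] (hk : Fintype.card κ = k) (c : γ → ℕ)
      (hc : c ∈ piAntidiag (univ : Finset γ) k),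
      ∑ u : κ → γ, (if cnt u = c then ∏ t, x (u t) else 0) =
        (Nat.multinomial univ c : ℝ) * ∏ z, x z ^ c z := by
    intro κ _ _ hk c hc
    simp at hc
    rw [← card_cnt (ι := κ) c (by rw [hc, hk]), ← Finset.sum_filter,
      Finset.sum_congr rfl (g := fun _ => ∏ z, x z ^ c z)]
    · simp
    · intro u hu; simp at hu; rw [prod_cnt, hu]
  unfold Wt
  have : ∀ c ∈ piAntidiag (univ : Finset γ) k,
      ((Nat.multinomial univ c : ℝ) * ∏ z, x z ^ c z) ^ 2 =
      ∑ u : ι → γ, ∑ v : ι' → γ, (if cnt u = c then ∏ t, x (u t) else 0) *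
        (if cnt v = c then ∏ t, x (v t) else 0) := by
    intro c hc
    rw [sq]
    nth_rewrite 1 [← key ι h c hc]
    rw [← key' ι' h' c hc, Finset.sum_mul_sum]
  refine Eq.trans ?_ (Finset.sum_congr rfl this).symm
  symm
  rw [Finset.sum_comm]
  refine Finset.sum_congr rfl fun u _ => ?_
  rw [Finset.sum_comm]
  refine Finset.sum_congr rfl fun (v : ι' → γ) _ => ?_
  rw [Finset.sum_eq_single (cnt u)]
  · by_cases huv : cnt u = cnt v
    · simp [huv]
    · simp [huv, Ne.symm huv]
  · intro c _ hc; simp [Ne.symm hc]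
  · intro hn; exfalso; apply hn; simp [sum_cnt, h]

def Bal {ι γ : Type*} (U V : Finset ι) (a : ι → γ) : Prop :=
  ∀ z, #{t ∈ U | a t = z} = #{t ∈ V | a t = z}

lemma bal_sum {ι γ : Type*} [Fintype ι] [DecidableEq ι] [Fintype γ] (x : γ → ℝ) (k r : ℕ) (U V : Finset ι)
    (hd : Disjoint U V) (hU : #U = k) (hV : #V = k) (hr : Fintype.card ι = 2 * k + r) :
    ∑ a : ι → γ, (if Bal U V a then ∏ t, x (a t) else 0) = (∑ z, x z) ^ r * Wt x k := by
  let W : Finset ι := (U ∪ V)ᶜ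
  have hW : #W = r := by
    rw [Finset.card_compl, Finset.card_union_of_disjoint hd]; omega
  let f : (U ⊕ V) ⊕ W → ι := Sum.elim (Sum.elim Subtype.val Subtype.val) Subtype.val
  have hf : Function.Bijective f := by
    constructor
    · have hd' := Finset.disjoint_left.1 hd
      rintro ((⟨a, ha⟩ | ⟨a, ha⟩) | ⟨a, ha⟩) ((⟨b, hb⟩ | ⟨b, hb⟩) | ⟨b, hb⟩) hab <;>
        simp [f, W] at hab ha hb ⊢ <;> subst hab <;> simp_all
    · intro t
      by_cases h1 : t ∈ U
      · exact ⟨Sum.inl (Sum.inl ⟨t, h1⟩), rfl⟩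
      by_cases h2 : t ∈ V
      · exact ⟨Sum.inl (Sum.inr ⟨t, h2⟩), rfl⟩
      · exact ⟨Sum.inr ⟨t, by simp [W, h1, h2]⟩, rfl⟩
  let e : (U ⊕ V) ⊕ W ≃ ι := Equiv.ofBijective f hf
  let E : (((U → γ) × (V → γ)) × (W → γ)) ≃ (ι → γ) :=
    ((Equiv.sumArrowEquivProdArrow U V γ).symm.prodCongr (Equiv.refl _)).trans
      ((Equiv.sumArrowEquivProdArrow (U ⊕ V) W γ).symm.trans (e.arrowCongr (Equiv.refl γ)))
  have hE : ∀ u v w t, E ((u, v), w) (f t) = Sum.elim (Sum.elim u v) w t := by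
    intro u v w t
    have : e.symm (f t) = t := e.symm_apply_apply t
    simp only [E, Equiv.trans_apply, Equiv.arrowCongr_apply, Function.comp, this]
    rcases t with (t | t) | t <;> rfl
  have hprod : ∀ u v w, ∏ t, x (E ((u, v), w) t) = ((∏ t, x (u t)) * ∏ t, x (v t)) * ∏ t, x (w t) := by
    intro u v w
    rw [← e.prod_comp]
    have : ∀ t, e t = f t := fun _ => rfl
    simp only [this, hE, Fintype.prod_sum_type, Sum.elim_inl, Sum.elim_inr]
  have hbal : ∀ u v w, Bal U V (E ((u, v), w)) ↔ cnt u = cnt v := by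
    intro u v w
    have h1 : ∀ z, #{t ∈ U | E ((u, v), w) t = z} = cnt u z := by
      intro z
      unfold cnt
      rw [← Finset.card_map (Function.Embedding.subtype _)]
      congr 1
      ext t
      simp only [Finset.mem_filter, Finset.mem_map, Finset.mem_univ, true_and,
        Function.Embedding.subtype_apply, Subtype.exists]
      constructor
      · rintro ⟨ht, h⟩
        refine ⟨t, ht, ?_, rfl⟩
        rw [← h]; exact (hE u v w (Sum.inl (Sum.inl ⟨t, ht⟩))).symm
      · rintro ⟨t, ht, h, rfl⟩
        refine ⟨ht, ?_⟩
        rw [← h]; exact (hE u v w (Sum.inl (Sum.inl ⟨t, ht⟩)))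
    have h2 : ∀ z, #{t ∈ V | E ((u, v), w) t = z} = cnt v z := by
      intro z
      unfold cnt
      rw [← Finset.card_map (Function.Embedding.subtype _)]
      congr 1
      ext t
      simp only [Finset.mem_filter, Finset.mem_map, Finset.mem_univ, true_and,
        Function.Embedding.subtype_apply, Subtype.exists]
      constructor
      · rintro ⟨ht, h⟩
        refine ⟨t, ht, ?_, rfl⟩
        rw [← h]; exact (hE u v w (Sum.inl (Sum.inr ⟨t, ht⟩))).symm
      · rintro ⟨t, ht, h, rfl⟩
        refine ⟨ht, ?_⟩
        rw [← h]; exact (hE u v w (Sum.inl (Sum.inr ⟨t, ht⟩)))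
    unfold Bal
    simp only [h1, h2]
    exact ⟨fun h => funext h, fun h z => by rw [h]⟩
  have hw : ∑ w : W → γ, ∏ t, x (w t) = (∑ z, x z) ^ r := by
    have := Finset.prod_univ_sum (fun _ : W => (univ : Finset γ)) (fun _ z => x z)
    simp only [Finset.prod_const, Finset.card_univ, Fintype.card_coe, hW,
      Fintype.piFinset_univ] at this
    exact this.symm
  rw [← E.sum_comp, Fintype.sum_prod_type, Fintype.sum_prod_type]
  simp only [hbal, hprod]
  rw [← pair_sum (ι := U) (ι' := V) x k (by simpa using hU) (by simpa using hV), mul_comm,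
    Finset.sum_mul]
  refine Finset.sum_congr rfl fun u _ => ?_
  rw [Finset.sum_mul]
  refine Finset.sum_congr rfl fun v _ => ?_
  rw [← hw, Finset.mul_sum]
  refine Finset.sum_congr rfl fun w _ => ?_
  split_ifs <;> simp

lemma Wt_bool (x : Bool → ℝ) (k : ℕ) :
    Wt x k = ∑ i ∈ range (k + 1), ((k.choose i : ℝ) * (x true ^ i * x false ^ (k - i))) ^ 2 := by
  unfold Wt
  refine Finset.sum_nbij' (fun c => c true) (fun i => fun b => if b then i else k - i) ?_ ?_ ?_ ?_ ?_
  · intro c hc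
    simp at hc
    simp; omega
  · intro i hi
    simp at hi
    simp; omega
  · intro c hc
    simp at hc
    funext b
    cases b
    · simp; omega
    · simp
  · intro i hi; simp
  · intro c hc
    simp at hc
    have h1 : Nat.multinomial univ c = k.choose (c true) := by
      have := Nat.binomial_eq_choose (f := c) (a := true) (b := false) (by simp)
      rw [hc] at this
      rw [← this]
      congr
    have h2 : c false = k - c true := by omega
    rw [h1, ← h2]
    simp

lemma Wt_bool_one (k : ℕ) : Wt (fun _ : Bool => 1) k = ((2 * k).choose k : ℝ) := by
  rw [Wt_bool]
  simp only [one_pow, mul_one]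
  rw [← Nat.sum_range_choose_sq]
  push_cast
  rfl

noncomputable def II : PowerSeries ℝ := PowerSeries.mk fun n => 1 / ((n.factorial : ℝ)) ^ 2

lemma Wt_one (γ : Type*) [Fintype γ] (k : ℕ) :
    Wt (fun _ : γ => 1) k = (k.factorial : ℝ) ^ 2 * PowerSeries.coeff k (II ^ Fintype.card γ) := by
  have h0 : (II ^ Fintype.card γ) = ∏ _z : γ, II := by simp
  rw [h0, PowerSeries.coeff_prod, Finset.mul_sum]
  unfold Wt
  refine Finset.sum_nbij' (fun c => Finsupp.equivFunOnFinite.symm c) (fun c => c) ?_ ?_ ?_ ?_ ?_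
  · intro c hc
    simp at hc
    simp [Finset.mem_finsuppAntidiag, hc]
  · intro c hc
    simp [Finset.mem_finsuppAntidiag] at hc
    simp [hc]
  · intro c hc
    simp
  · intro c hc
    ext; simp
  · intro c hc
    simp at hc
    have := Nat.multinomial_spec univ c
    rw [hc] at this
    rw [← this]
    push_cast
    simp only [II, PowerSeries.coeff_mk, Finsupp.equivFunOnFinite_symm_apply_apply, one_pow,
      Finset.prod_const_one, mul_one, Finset.prod_div_distrib, Finset.prod_pow]
    have : (∏ i, ((c i).factorial : ℝ)) ≠ 0 :=
      Finset.prod_ne_zero_iff.2 fun i _ => by positivity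
    field_simp

open PowerSeries in
lemma II_ode : X * derivative ℝ (derivative ℝ II) + derivative ℝ II = II := by
  ext n
  rcases n with _ | n
  · rw [map_add, coeff_derivative]
    simp [II]
  · rw [map_add, coeff_succ_X_mul, coeff_derivative, coeff_derivative]
    simp only [II, coeff_mk, Nat.factorial_succ]
    push_cast
    have : (n.factorial : ℝ) ≠ 0 := by positivity
    field_simp

open PowerSeries in
lemma II_sq (j : ℕ) : coeff j (II ^ 2) = ((2 * j).choose j : ℝ) / (j.factorial : ℝ) ^ 2 := by
  rw [sq, coeff_mul, two_mul, Nat.add_choose_eq]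
  push_cast
  rw [Finset.sum_div]
  refine Finset.sum_congr rfl fun q hq => ?_
  simp at hq
  obtain ⟨a, b⟩ := q
  simp at hq
  subst hq
  simp only [II, coeff_mk]
  rw [Nat.choose_symm_add, Nat.add_choose]
  rw [Nat.cast_div (Nat.factorial_mul_factorial_dvd_factorial_add a b) (by positivity)]
  have h1 : (a.factorial : ℝ) ≠ 0 := by positivity
  have h2 : (b.factorial : ℝ) ≠ 0 := by positivity
  have h3 : ((a+b).factorial : ℝ) ≠ 0 := by positivity
  push_cast
  field_simp

open PowerSeries in
lemma II_der (j : ℕ) : coeff j (X * (derivative ℝ II) ^ 2) * ((j : ℝ) + 1) =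
    (j : ℝ) * coeff j (II ^ 2) := by
  rcases j with _ | n
  · simp
  · rw [coeff_succ_X_mul, II_sq, sq, coeff_mul]
    have h : ((2 * (n+1)).choose (n+1) : ℝ) * (n + 1) = ((2 * (n+1)).choose n : ℝ) * (n + 2) := by
      have := Nat.choose_succ_right_eq (2 * (n+1)) n
      have h' : 2 * (n+1) - n = n + 2 := by omega
      rw [h'] at this
      exact_mod_cast this
    have h2 : ∑ q ∈ antidiagonal n, coeff q.1 (derivative ℝ II) * coeff q.2 (derivative ℝ II)
        = ((2 * (n+1)).choose n : ℝ) / ((n+1).factorial : ℝ) ^ 2 := by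
      rw [two_mul, Nat.add_choose_eq]
      push_cast
      rw [Finset.sum_div]
      refine Finset.sum_congr rfl fun q hq => ?_
      simp at hq
      obtain ⟨a, b⟩ := q
      simp at hq
      subst hq
      simp only [II, coeff_derivative, coeff_mk]
      rw [Nat.cast_choose ℝ (show a ≤ a + b + 1 by omega),
        Nat.cast_choose ℝ (show b ≤ a + b + 1 by omega),
        show a + b + 1 - a = b + 1 by omega, show a + b + 1 - b = a + 1 by omega]
      simp only [Nat.factorial_succ]
      have h1 : (a.factorial : ℝ) ≠ 0 := by positivity
      have h2 : (b.factorial : ℝ) ≠ 0 := by positivity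
      have h3 : ((a+b).factorial : ℝ) ≠ 0 := by positivity
      push_cast
      field_simp
    rw [h2]
    push_cast
    have h3 : ((n+1).factorial : ℝ) ≠ 0 := by positivity
    field_simp
    linarith

open PowerSeries in
lemma II_pow_ode (m : ℕ) : X * derivative ℝ (derivative ℝ (II ^ (m+2))) + derivative ℝ (II ^ (m+2))
    = C ((m : ℝ) + 2) * II ^ (m+2)
      + C (((m : ℝ) + 2) * (m + 1)) * (II ^ m * (X * (derivative ℝ II) ^ 2)) := by
  have h := II_ode
  have e1 : derivative ℝ (II ^ (m+2)) = C ((m : ℝ) + 2) * (II ^ (m+1) * derivative ℝ II) := by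
    rw [Derivation.leibniz_pow, map_add, show (C (2:ℝ) : PowerSeries ℝ) = 2 from map_ofNat C 2]
    simp [smul_eq_mul]
  have e2 : derivative ℝ (II ^ (m+1)) = C ((m : ℝ) + 1) * (II ^ m * derivative ℝ II) := by
    rw [Derivation.leibniz_pow]
    simp [smul_eq_mul]
  have e3 : derivative ℝ (derivative ℝ (II ^ (m+2))) = C ((m : ℝ) + 2) *
      (II ^ (m+1) * derivative ℝ (derivative ℝ II) +
        derivative ℝ II * (C ((m : ℝ) + 1) * (II ^ m * derivative ℝ II))) := by
    rw [e1, Derivation.leibniz, Derivation.leibniz, e2]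
    simp [smul_eq_mul]
  rw [e3, e1, map_mul]
  have : C ((m : ℝ) + 2) * II ^ (m+2) = C ((m : ℝ) + 2) * II ^ (m+1) *
     (X * derivative ℝ (derivative ℝ II) + derivative ℝ II) := by rw [h]; ring
  rw [this]
  ring

open PowerSeries in
lemma coeff_id (m j : ℕ) : ((j : ℝ) + 1) ^ 2 * coeff (j+1) (II ^ (m+2)) =
    (m + 2) * coeff j (II ^ (m+2)) +
      (m + 2) * (m + 1) * coeff j (II ^ m * (X * (derivative ℝ II) ^ 2)) := by
  have h := congrArg (coeff j) (II_pow_ode m)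
  rw [map_add, map_add, coeff_C_mul, coeff_C_mul] at h
  rw [← h, coeff_derivative]
  rcases j with _ | n
  · simp
  · rw [coeff_succ_X_mul, coeff_derivative, coeff_derivative]
    push_cast
    ring

open PowerSeries in
lemma coeff_nonneg (m j : ℕ) : 0 ≤ coeff j (II ^ m) := by
  rw [coeff_pow]
  refine Finset.sum_nonneg fun l _ => Finset.prod_nonneg fun i _ => ?_
  simp only [II, coeff_mk]; positivity

open PowerSeries in
lemma coeff_le (m j : ℕ) : ((j : ℝ) + 1) * coeff j (II ^ m * (X * (derivative ℝ II) ^ 2)) ≤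
    j * coeff j (II ^ (m+2)) := by
  rw [pow_add, coeff_mul, coeff_mul, Finset.mul_sum, Finset.mul_sum]
  refine Finset.sum_le_sum fun q hq => ?_
  simp at hq
  have h1 := II_der q.2
  have h2 := coeff_nonneg m q.1
  have h3 := coeff_nonneg 2 q.2
  have h4 : (q.2 : ℝ) ≤ j := by exact_mod_cast (by omega)
  have h5 : coeff q.2 (X * (derivative ℝ II) ^ 2) =
      (q.2 : ℝ) / ((q.2 : ℝ) + 1) * coeff q.2 (II ^ 2) := by
    field_simp; linarith
  rw [h5]
  have h6 : ((j : ℝ) + 1) * ((q.2 : ℝ) / ((q.2 : ℝ) + 1)) ≤ j := by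
    rw [mul_div_assoc', div_le_iff₀ (by positivity)]; nlinarith
  have h7 := mul_le_mul_of_nonneg_right h6 (mul_nonneg h2 h3)
  linarith

/-- the ratio bound -/
lemma Wt_ratio (m j : ℕ) : Wt (fun _ : Fin (m+2) => 1) (j+1) * (2 * j + 2) ≤
    ((m : ℝ) + 2) ^ 2 * (2 * j + 1) * Wt (fun _ : Fin (m+2) => 1) j := by
  rw [Wt_one, Wt_one, Fintype.card_fin, Nat.factorial_succ]
  have h1 := coeff_id m j
  have h2 := coeff_le m j
  have h3 := coeff_nonneg (m+2) j
  push_cast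
  have h4 : ((j : ℝ) + 1) ^ 2 * PowerSeries.coeff (j+1) (II ^ (m+2)) * (2 * j + 2) ≤
      ((m : ℝ) + 2) ^ 2 * (2 * j + 1) * PowerSeries.coeff j (II ^ (m+2)) := by
    rw [h1]
    have h5 := mul_le_mul_of_nonneg_left h2 (show (0:ℝ) ≤ 2 * ((m + 2) * (m + 1)) by positivity)
    have h6 : (0:ℝ) ≤ (m + 2) * m * PowerSeries.coeff j (II ^ (m+2)) := by positivity
    nlinarith
  have h5 := mul_le_mul_of_nonneg_left h4 (show (0:ℝ) ≤ (j.factorial : ℝ) ^ 2 by positivity)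
  linarith

lemma coeff_zero' (m : ℕ) : PowerSeries.coeff 0 (II ^ m) = 1 := by
  simp [II]

lemma Wt_fin_one (m : ℕ) : Wt (fun _ : Fin (m+2) => 1) 1 = m + 2 := by
  rw [Wt_one, Fintype.card_fin]
  have h1 := coeff_id m 0
  rw [coeff_zero'] at h1
  simp at h1
  simp [h1]

lemma Wt_fin_two (m : ℕ) : Wt (fun _ : Fin (m+2) => 1) 2 = 2 * ((m:ℝ) + 2) ^ 2 - (m + 2) := by
  rw [Wt_one, Fintype.card_fin]
  have h1 := coeff_id m 1
  have h0 := coeff_id m 0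
  rw [coeff_zero'] at h0
  simp at h0
  rw [show II ^ m * (PowerSeries.X * (PowerSeries.derivative ℝ II) ^ 2) =
    PowerSeries.X * (II ^ m * (PowerSeries.derivative ℝ II) ^ 2) by ring,
    PowerSeries.coeff_succ_X_mul] at h1
  have h2 : PowerSeries.coeff 0 (II ^ m * (PowerSeries.derivative ℝ II) ^ 2) = 1 := by
    have : PowerSeries.constantCoeff (PowerSeries.derivative ℝ II) = 1 := by
      rw [← PowerSeries.coeff_zero_eq_constantCoeff_apply, PowerSeries.coeff_derivative]
      simp [II]
    have h3 := coeff_zero' m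
    rw [PowerSeries.coeff_zero_eq_constantCoeff_apply] at h3 ⊢
    simp only [map_mul, map_pow] at h3 ⊢
    rw [h3, this]; simp
  rw [h2, h0] at h1
  simp [Nat.factorial] at h1 ⊢
  linarith

/-- `P_M(k) ≤ P_2(k)/2` -/
lemma Wt_bound (m k : ℕ) : 2 * 4 ^ (k+2) * Wt (fun _ : Fin (m+3) => 1) (k+2) ≤
    ((m:ℝ) + 3) ^ (2 * (k+2)) * ((2 * (k+2)).choose (k+2) : ℝ) := by
  induction k with
  | zero =>
    have h := Wt_fin_two (m+1)
    push_cast at h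
    rw [show m + 1 + 2 = m + 3 by omega] at h
    simp only [Nat.zero_add]
    rw [h]
    simp [Nat.choose]
    have hm : (0:ℝ) ≤ m := by positivity
    nlinarith [mul_nonneg hm hm, mul_nonneg hm (mul_nonneg hm hm), mul_nonneg (mul_nonneg hm hm) (mul_nonneg hm hm)]
  | succ k ih =>
    have h := Wt_ratio (m+1) (k+2)
    rw [show m + 1 + 2 = m + 3 by omega] at h
    push_cast at h
    have hc := Nat.succ_mul_centralBinom_succ (k+2)
    rw [Nat.centralBinom_eq_two_mul_choose, Nat.centralBinom_eq_two_mul_choose] at hc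
    have hc' : ((k:ℝ) + 2 + 1) * ((2 * (k + 2 + 1)).choose (k+2+1) : ℝ)
        = 2 * (2 * (k + 2) + 1) * ((2 * (k+2)).choose (k+2) : ℝ) := by exact_mod_cast hc
    rw [show k + 1 + 2 = k + 2 + 1 by omega]
    have hpos : (0:ℝ) < 2 * ((k:ℝ) + 2) + 2 := by positivity
    refine le_of_mul_le_mul_right ?_ hpos
    have e1 := mul_le_mul_of_nonneg_left h (show (0:ℝ) ≤ 2 * 4 ^ (k+2+1) by positivity)
    have e2 := mul_le_mul_of_nonneg_left ih
      (show (0:ℝ) ≤ 4 * ((m:ℝ)+3)^2 * (2 * ((k:ℝ) + 2) + 1) by positivity)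
    have e3 : ((m:ℝ) + 3) ^ (2 * (k+2+1)) * ((2 * (k+2+1)).choose (k+2+1) : ℝ) * (2 * ((k:ℝ)+2)+2)
       = 4 * ((m:ℝ)+3)^2 * (2 * ((k:ℝ) + 2) + 1) * (((m:ℝ) + 3) ^ (2 * (k+2)) *
          ((2 * (k+2)).choose (k+2) : ℝ)) := by
      have : ((m:ℝ) + 3) ^ (2 * (k+2+1)) = ((m:ℝ) + 3) ^ (2 * (k+2)) * (m+3)^2 := by
        rw [← pow_add]; congr 1
      rw [this]
      linear_combination 2 * ((m:ℝ) + 3) ^ (2 * (k+2)) * (m+3)^2 * hc'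
    rw [e3]
    refine le_trans ?_ e2
    have e4 : ((m:ℝ) + 1 + 2) = m + 3 := by ring
    rw [e4] at e1
    refine le_trans (le_of_eq ?_) (e1.trans (le_of_eq ?_))
    · ring
    · ring
open Polynomial in
lemma coeff_lin (a b : ℝ) (n i : ℕ) :
    ((C a * X + C b) ^ n).coeff i = n.choose i * (a ^ i * b ^ (n - i)) := by
  have h : (C a * X + C b) ^ n = ∑ m ∈ range (n+1), C (a ^ m * b ^ (n-m) * n.choose m) * X ^ m := by
    rw [add_pow]
    refine Finset.sum_congr rfl fun m _ => ?_
    simp only [mul_pow, map_mul, map_pow, map_natCast]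
    ring
  rw [h, finsetSum_coeff]
  simp only [coeff_C_mul_X_pow]
  rw [Finset.sum_ite_eq]
  split_ifs with hi
  · ring
  · simp at hi
    rw [Nat.choose_eq_zero_of_lt (by omega)]; simp

open Polynomial in
lemma T_id (x : ℝ) (l : ℕ) :
    ∑ i ∈ range (l + 1), ((l.choose i : ℝ) * (x ^ i * (x+1) ^ (l - i))) ^ 2 =
    ∑ i ∈ range (l + 1), (l.choose i : ℝ) * (x * (x+1)) ^ i * ((2 * i).choose i : ℝ) := by
  have h1 : ((C x * X + C (x+1)) ^ l * (C (x+1) * X + C x) ^ l).coeff l =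
      ∑ i ∈ range (l + 1), ((l.choose i : ℝ) * (x ^ i * (x+1) ^ (l - i))) ^ 2 := by
    rw [coeff_mul, Finset.Nat.sum_antidiagonal_eq_sum_range_succ_mk]
    refine Finset.sum_congr rfl fun i hi => ?_
    simp at hi
    have hi' : i ≤ l := by omega
    rw [coeff_lin, coeff_lin]
    simp only
    rw [Nat.choose_symm hi', Nat.sub_sub_self hi']
    ring
  have h2 : (C x * X + C (x+1)) ^ l * (C (x+1) * X + C x) ^ l =
      ∑ i ∈ range (l + 1), C ((l.choose i : ℝ) * (x * (x+1)) ^ i) * ((1 + X) ^ (2 * i) * X ^ (l - i)) := by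
    rw [← mul_pow, show (C x * X + C (x+1)) * (C (x+1) * X + C x) =
      C (x * (x+1)) * (1 + X) ^ 2 + X by simp only [map_mul, map_add, map_one]; ring, add_pow]
    refine Finset.sum_congr rfl fun m _ => ?_
    simp only [mul_pow, map_mul, map_pow, map_natCast, pow_mul]
    ring
  rw [← h1, h2, finsetSum_coeff]
  refine Finset.sum_congr rfl fun i hi => ?_
  simp at hi
  have hi' : i ≤ l := by omega
  rw [coeff_C_mul, coeff_mul_X_pow', if_pos (by omega), Nat.sub_sub_self hi', coeff_one_add_X_pow]

lemma central_mono (i d : ℕ) : ((2 * i).choose i : ℝ) * (i + 1) * 4 ^ d ≤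
    ((2 * (i + d)).choose (i + d) : ℝ) * (i + d + 1) := by
  induction d with
  | zero => simp
  | succ d ih =>
    have hc := Nat.succ_mul_centralBinom_succ (i+d)
    rw [Nat.centralBinom_eq_two_mul_choose, Nat.centralBinom_eq_two_mul_choose] at hc
    have hc' : ((i:ℝ) + d + 1) * ((2 * (i + d + 1)).choose (i + d + 1) : ℝ)
        = 2 * (2 * (i + d) + 1) * ((2 * (i+d)).choose (i+d) : ℝ) := by exact_mod_cast hc
    rw [← add_assoc, pow_succ]
    push_cast
    set A := ((2 * (i + d + 1)).choose (i + d + 1) : ℝ)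
    set B := ((2 * (i+d)).choose (i+d) : ℝ)
    have hB : 0 ≤ B := by positivity
    have hs : (0:ℝ) < (i:ℝ) + d + 1 := by positivity
    have : 4 * (B * (i + d + 1)) ≤ A * (i + (d + 1) + 1) := by
      refine le_of_mul_le_mul_left ?_ hs
      have : (0:ℝ) ≤ B * (i + d) := by positivity
      nlinarith
    linarith

lemma T_bound (x : ℝ) (hx : 1 ≤ x) (l : ℕ) :
    8 * 4 ^ l * ∑ i ∈ range (l + 1), ((l.choose i : ℝ) * (x ^ i * (x+1) ^ (l - i))) ^ 2 ≤
    9 * ((x + (x + 1)) ^ (2 * l) * ((2 * l).choose l : ℝ)) := by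
  rw [T_id]
  set t := x * (x + 1) with ht
  have ht2 : 2 ≤ t := by nlinarith
  set Cl := ((2 * l).choose l : ℝ) with hCl
  have hCl0 : 0 ≤ Cl := by positivity
  have h1 : ∀ i ∈ range (l+1), 4 ^ l * ((l.choose i : ℝ) * t ^ i * ((2 * i).choose i : ℝ)) * (4 * t) ≤
      Cl * (((l+1).choose (i+1) : ℝ) * (4 * t) ^ (i+1)) := by
    intro i hi
    simp at hi
    obtain ⟨d, rfl⟩ : ∃ d, l = i + d := ⟨l - i, by omega⟩
    have h := central_mono i d
    have hh := Nat.add_one_mul_choose_eq (i + d) i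
    have hh' : ((i:ℝ) + d + 1) * ((i+d).choose i : ℝ) = ((i+d+1).choose (i+1) : ℝ) * (i + 1) := by
      exact_mod_cast hh
    have hs : (0:ℝ) < (i:ℝ) + 1 := by positivity
    refine le_of_mul_le_mul_right ?_ hs
    have e := mul_le_mul_of_nonneg_right h
      (show 0 ≤ ((i+d).choose i : ℝ) * (4 * t) ^ (i + 1) by positivity)
    refine le_trans (le_of_eq ?_) (e.trans (le_of_eq ?_))
    · clear_value t
      rw [pow_add, mul_pow, pow_succ, pow_succ]; ring
    · rw [hCl]
      linear_combination ((2 * (i + d)).choose (i + d) : ℝ) * (4 * t) ^ (i+1) * hh'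
  have h2 : ∑ i ∈ range (l+1), ((l+1).choose (i+1) : ℝ) * (4 * t) ^ (i+1) ≤ (4 * t + 1) ^ (l+1) := by
    rw [add_pow, Finset.sum_range_succ' _ (l+1)]
    refine le_trans (le_of_eq (Finset.sum_congr rfl fun i _ => ?_)) (le_add_of_nonneg_right ?_)
    · simp [mul_comm]
    · positivity
  have h3 : 4 ^ l * (∑ i ∈ range (l + 1), (l.choose i : ℝ) * t ^ i * ((2 * i).choose i : ℝ)) * (4 * t)
      ≤ Cl * (4 * t + 1) ^ (l+1) := by
    rw [Finset.mul_sum, Finset.sum_mul]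
    refine (Finset.sum_le_sum h1).trans ?_
    rw [← Finset.mul_sum]
    exact mul_le_mul_of_nonneg_left h2 hCl0
  have h4 : (x + (x+1)) ^ (2 * l) = (4 * t + 1) ^ l := by
    rw [pow_mul]; congr 1; rw [ht]; ring
  rw [h4]
  have h5 : (0:ℝ) < 4 * t := by linarith
  refine le_of_mul_le_mul_right ?_ h5
  have h6 : 0 ≤ Cl * (4 * t + 1) ^ l := by positivity
  rw [pow_succ] at h3
  nlinarith

lemma central_facts (l : ℕ) (hl : 1 ≤ l) : 2 * ((2 * l).choose l : ℝ) ≤ 4 ^ l := by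
  induction l, hl using Nat.le_induction with
  | base => norm_num [Nat.choose]
  | succ l hl ih =>
    have hc := Nat.succ_mul_centralBinom_succ l
    rw [Nat.centralBinom_eq_two_mul_choose, Nat.centralBinom_eq_two_mul_choose] at hc
    have hc' : ((l:ℝ) + 1) * ((2 * (l + 1)).choose (l + 1) : ℝ)
        = 2 * (2 * l + 1) * ((2 * l).choose l : ℝ) := by exact_mod_cast hc
    have : (0:ℝ) ≤ ((2 * l).choose l : ℝ) := by positivity
    rw [pow_succ]
    have hs : (0:ℝ) < (l:ℝ) + 1 := by positivity
    refine le_of_mul_le_mul_left ?_ hs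
    nlinarith

lemma central_six (l : ℕ) (hl : 2 ≤ l) : (6:ℝ) ≤ ((2 * l).choose l : ℝ) := by
  have h : Nat.centralBinom 2 ≤ Nat.centralBinom l := by
    induction l, hl using Nat.le_induction with
    | base => rfl
    | succ l hl ih =>
      refine ih.trans ?_
      have := Nat.succ_mul_centralBinom_succ l
      have h0 := Nat.centralBinom_pos l
      nlinarith
  rw [Nat.centralBinom_eq_two_mul_choose, Nat.centralBinom_eq_two_mul_choose] at h
  have h6 : (2 * 2).choose 2 = 6 := by decide
  rw [h6] at h
  exact_mod_cast h

lemma numB (x y l r : ℕ) (hx : 1 ≤ x) (hy : y = x ∨ y = x + 1) (hl : 1 ≤ l) :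
    4 * ((2:ℝ) ^ (2 * l + r) - 2) * (((x:ℝ) + y) ^ r * Wt (fun b : Bool => if b then (x:ℝ) else y) l
      - ((x:ℝ) ^ (2 * l + r) + (y:ℝ) ^ (2 * l + r))) ≤
    5 * (((x:ℝ) + y) ^ (2 * l + r) - ((x:ℝ) ^ (2 * l + r) + (y:ℝ) ^ (2 * l + r))) *
      ((2:ℝ) ^ r * ((2 * l).choose l : ℝ) - 2) := by
  have hx1 : (1:ℝ) ≤ x := by exact_mod_cast hx
  rw [Wt_bool]
  have hC2 : (2:ℝ) ≤ ((2 * l).choose l : ℝ) := by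
    rcases Nat.lt_or_ge l 2 with h | h
    · obtain rfl : l = 1 := by omega
      norm_num [Nat.choose]
    · linarith [central_six l h]
  have h2r : (1:ℝ) ≤ 2 ^ r := one_le_pow₀ (by norm_num)
  have hCr : (2:ℝ) ≤ 2 ^ r * ((2 * l).choose l : ℝ) := by nlinarith
  have hpp : (2:ℝ) ^ (2 * l + r) = 4 ^ l * 2 ^ r := by
    rw [pow_add, pow_mul]; norm_num
  have h4l : (4:ℝ) ≤ 4 ^ l := by
    calc (4:ℝ) = 4 ^ 1 := by norm_num
      _ ≤ 4 ^ l := pow_le_pow_right₀ (by norm_num) hl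
  have hp2 : (4:ℝ) ≤ 2 ^ (2 * l + r) := by rw [hpp]; nlinarith
  rcases hy with rfl | rfl
  · have e : ∑ i ∈ range (l + 1), ((l.choose i : ℝ) * ((if true = true then (y:ℝ) else y) ^ i *
        (if false = true then (y:ℝ) else y) ^ (l - i))) ^ 2 = (y:ℝ) ^ (2 * l) * ((2*l).choose l : ℝ) := by
      rw [← Nat.sum_range_choose_sq]
      push_cast
      rw [Finset.mul_sum]
      refine Finset.sum_congr rfl fun i hi => ?_
      simp at hi
      have : (y:ℝ) ^ i * (y:ℝ) ^ (l - i) = y ^ l := by rw [← pow_add]; congr 1; omega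
      simp only [ite_self, this, mul_pow]
      ring
    rw [e]
    have e1 : ((y:ℝ) + y) ^ r * ((y:ℝ) ^ (2 * l) * ((2*l).choose l : ℝ)) =
      y ^ (2 * l + r) * (2 ^ r * ((2*l).choose l : ℝ)) := by
      rw [← two_mul, mul_pow, pow_add]; ring
    have e2 : ((y:ℝ) + y) ^ (2 * l + r) = y ^ (2 * l + r) * 2 ^ (2 * l + r) := by
      rw [← two_mul, mul_pow]; ring
    rw [e1, e2]
    set Y := (y:ℝ) ^ (2 * l + r)
    have hY : 0 ≤ Y := by positivity
    have : 0 ≤ Y * ((2:ℝ) ^ (2 * l + r) - 2) * (2 ^ r * ((2*l).choose l : ℝ) - 2) := by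
      refine mul_nonneg (mul_nonneg hY (by linarith)) (by linarith)
    nlinarith
  · by_cases h2 : l = 1 ∧ r = 0
    · obtain ⟨rfl, rfl⟩ := h2
      simp [Finset.sum_range_succ, Nat.choose]
      ring_nf
      rfl
    have hT := T_bound (x:ℝ) hx1 l
    push_cast
    simp only [if_true, Bool.false_eq_true, if_false]
    set T := ∑ i ∈ range (l + 1), ((l.choose i : ℝ) * ((x:ℝ) ^ i * ((x:ℝ)+1) ^ (l - i))) ^ 2
    have hD : ((x:ℝ) + (x + 1)) ^ (2 * l + r) * 2 ≤
        2 ^ (2 * l + r) * ((x:ℝ) ^ (2 * l + r) + ((x:ℝ)+1) ^ (2 * l + r)) := by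
      have h := add_pow_le (show (0:ℝ) ≤ x by positivity) (show (0:ℝ) ≤ x + 1 by positivity) (2 * l + r)
      have : (2:ℝ) ^ (2 * l + r) = 2 ^ (2 * l + r - 1) * 2 := by
        rw [← pow_succ]; congr 1; omega
      rw [this]
      linarith
    set D := (x:ℝ) ^ (2 * l + r) + ((x:ℝ)+1) ^ (2 * l + r)
    have hE0 : 0 < ((x:ℝ) + (x + 1)) ^ (2 * l + r) := by positivity
    have hG : 8 * (2 ^ (2 * l + r) * (((x:ℝ) + (x + 1)) ^ r * T)) ≤
        9 * (((x:ℝ) + (x + 1)) ^ (2 * l + r) * (2 ^ r * ((2 * l).choose l : ℝ))) := by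
      rw [hpp, pow_add]
      have := mul_le_mul_of_nonneg_left hT
        (show 0 ≤ 2 ^ r * ((x:ℝ) + (x + 1)) ^ r by positivity)
      linarith
    have hC4 : (4:ℝ) ≤ 2 ^ r * ((2 * l).choose l : ℝ) := by
      rcases Nat.lt_or_ge l 2 with h | h
      · obtain rfl : l = 1 := by omega
        have hr : 1 ≤ r := by omega
        have : (2:ℝ) ≤ 2 ^ r := by
          calc (2:ℝ) = 2 ^ 1 := by norm_num
            _ ≤ 2 ^ r := pow_le_pow_right₀ (by norm_num) hr
        norm_num [Nat.choose]
        linarith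
      · have := central_six l h
        nlinarith
    have hPB : 2 * (2 ^ r * ((2 * l).choose l : ℝ)) ≤ 2 ^ (2 * l + r) := by
      rw [hpp]
      have := mul_le_mul_of_nonneg_left (central_facts l hl) (show (0:ℝ) ≤ 2 ^ r by positivity)
      linarith
    set E := ((x:ℝ) + (x + 1)) ^ (2 * l + r)
    set G := ((x:ℝ) + (x + 1)) ^ r * T
    set Q := (2:ℝ) ^ r * ((2 * l).choose l : ℝ)
    set A := (2:ℝ) ^ (2 * l + r)
    -- 4 (A-2)(G-D) ≤ 5 (E-D)(Q-2)
    have hA : 0 < A := by linarith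
    refine le_of_mul_le_mul_left ?_ hA
    have e1 : 4 * (A - 2) * (A * G) ≤ 4 * (A - 2) * (9 / 8 * (E * Q)) :=
      mul_le_mul_of_nonneg_left (by linarith) (by linarith)
    have e2 : 0 ≤ (A * D - 2 * E) * (4 * (A - 2) - 5 * (Q - 2)) :=
      mul_nonneg (by linarith) (by linarith)
    have e3 : 0 ≤ E * (A - 2) * (Q - 4) := mul_nonneg (mul_nonneg hE0.le (by linarith)) (by linarith)
    nlinarith

lemma numA (m k r : ℕ) (hk : 1 ≤ k) :
    5 * ((2:ℝ) ^ (2 * k + r) - 2) * (((m:ℝ) + 3) ^ r * Wt (fun _ : Fin (m+3) => 1) k - (m + 3)) ≤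
    4 * (((m:ℝ) + 3) ^ (2 * k + r) - (m + 3)) * ((2:ℝ) ^ r * ((2 * k).choose k : ℝ) - 2) := by
  have hm : (0:ℝ) ≤ m := by positivity
  have h2r : (1:ℝ) ≤ 2 ^ r := one_le_pow₀ (by norm_num)
  have hpp : (2:ℝ) ^ (2 * k + r) = 4 ^ k * 2 ^ r := by
    rw [pow_add, pow_mul]; norm_num
  rcases Nat.lt_or_ge k 2 with h | h
  · obtain rfl : k = 1 := by omega
    have h := Wt_fin_one (m+1)
    push_cast at h
    rw [show m + 1 + 2 = m + 3 by omega] at h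
    rw [h, hpp]
    norm_num [Nat.choose, pow_add]
    set M := (m:ℝ) + 3 with hM
    have hM3 : 3 ≤ M := by linarith
    have e0 : (m:ℝ) + 1 + 2 = M := by rw [hM]; ring
    rw [e0]
    set x := M ^ r with hx
    set y := (2:ℝ) ^ r with hy
    have key : 5 * (2 * y - 1) * (x - 1) ≤ 4 * (M * x - 1) * (y - 1) := by
      rcases r with _ | _ | r
      · simp [hx, hy]
      · simp [hx, hy]
        nlinarith
      · have hy4 : 4 ≤ y := by
          rw [hy, pow_succ, pow_succ]
          have : (1:ℝ) ≤ 2 ^ r := one_le_pow₀ (by norm_num)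
          linarith
        have hx1 : 1 ≤ x := one_le_pow₀ (by linarith)
        have e1 : 0 ≤ (M - 3) * x * (y - 1) :=
          mul_nonneg (mul_nonneg (by linarith) (by linarith)) (by linarith)
        have e2 : 0 ≤ x * (y - 4) := mul_nonneg (by linarith) (by linarith)
        nlinarith
    have := mul_le_mul_of_nonneg_left key (show 0 ≤ 2 * M by linarith)
    nlinarith
  · obtain ⟨k, rfl⟩ : ∃ j, k = j + 2 := ⟨k - 2, by omega⟩
    have hw := Wt_bound m k
    have hC6 := central_six (k+2) (by omega)
    have hPB0 := central_facts (k+2) (by omega)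
    have hPB : 2 * (2 ^ r * ((2 * (k+2)).choose (k+2) : ℝ)) ≤ 2 ^ (2 * (k+2) + r) := by
      rw [hpp]
      have := mul_le_mul_of_nonneg_left hPB0 (show (0:ℝ) ≤ 2 ^ r by positivity)
      linarith
    have hG : 2 * (2 ^ (2 * (k+2) + r) * (((m:ℝ) + 3) ^ r * Wt (fun _ : Fin (m+3) => 1) (k+2))) ≤
        ((m:ℝ) + 3) ^ (2 * (k+2) + r) * (2 ^ r * ((2 * (k+2)).choose (k+2) : ℝ)) := by
      rw [hpp, pow_add ((m:ℝ)+3) (2*(k+2)) r]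
      have := mul_le_mul_of_nonneg_left hw
        (show 0 ≤ 2 ^ r * ((m:ℝ) + 3) ^ r by positivity)
      linarith
    have hQ6 : 6 ≤ 2 ^ r * ((2 * (k+2)).choose (k+2) : ℝ) := by nlinarith
    have hE0 : 0 < ((m:ℝ) + 3) ^ (2 * (k+2) + r) := by positivity
    set G := ((m:ℝ) + 3) ^ r * Wt (fun _ : Fin (m+3) => 1) (k+2)
    set E := ((m:ℝ) + 3) ^ (2 * (k+2) + r)
    set Q := (2:ℝ) ^ r * ((2 * (k+2)).choose (k+2) : ℝ)
    set A := (2:ℝ) ^ (2 * (k+2) + r)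
    set M := (m:ℝ) + 3
    have hM3 : 3 ≤ M := by simp only [M]; linarith
    have hA : 0 < A := by linarith
    refine le_of_mul_le_mul_left ?_ hA
    have e1 : 5 * (A - 2) * (A * G) ≤ 5 * (A - 2) * (1 / 2 * (E * Q)) :=
      mul_le_mul_of_nonneg_left (by linarith) (by linarith)
    have e2 : 0 ≤ A * M * (5 * (A - 2) - 4 * (Q - 2)) :=
      mul_nonneg (mul_nonneg hA.le (by linarith)) (by linarith)
    have e3 : 0 ≤ E * A * (3 * Q - 16) := mul_nonneg (mul_nonneg hE0.le hA.le) (by linarith)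
    have e4 : 0 ≤ E * Q := mul_nonneg hE0.le (by linarith)
    nlinarith

section cmp
variable {ι α β γ : Type} [Fintype ι] [DecidableEq ι]

def Compat (S : Equiv.Perm ι) (a : ι → α) (b : ι → β) : Prop :=
  ∀ x y, #{t | a t = x ∧ b t = y} = #{t | a t = x ∧ b (S t) = y}

def NC (a : ι → α) : Prop := ∃ t s, a t ≠ a s

def Tr (S : Equiv.Perm ι) : Prop :=
  ∀ c : ι → Bool, (∀ t, c (S t) = c t) → ∀ t s, c t = c s

theorem compat_symm_imp (S : Equiv.Perm ι) (a : ι → α) (b : ι → β) (h : Compat S a b) :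
    Compat S⁻¹ b a := by
  intro y x
  have h1 := h x y
  have h2 : #{t | b t = y ∧ a (S⁻¹ t) = x} = #{t | a t = x ∧ b (S t) = y} := by
    refine Finset.card_equiv S⁻¹ ?_
    intro t
    simp [and_comm]
  rw [h2, ← h1]
  congr 1
  ext t
  simp [and_comm]

theorem compat_symm (S : Equiv.Perm ι) (a : ι → α) (b : ι → β) :
    Compat S a b ↔ Compat S⁻¹ b a := by
  refine ⟨compat_symm_imp S a b, fun h => ?_⟩
  have := compat_symm_imp _ _ _ h
  rwa [inv_inv] at this

theorem compat_map [Fintype β] (S : Equiv.Perm ι) (a : ι → α) (b : ι → β) (f : β → γ) (h : Compat S a b) :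
    Compat S a (fun t => f (b t)) := by
  intro x z
  have key : ∀ g : ι → β, #{t | a t = x ∧ f (g t) = z} =
      ∑ y ∈ univ.filter (fun y => f y = z), #{t | a t = x ∧ g t = y} := by
    intro g
    rw [Finset.card_eq_sum_card_fiberwise (f := g) (t := univ.filter (fun y => f y = z))]
    · refine Finset.sum_congr rfl fun y hy => ?_
      congr 1
      ext t
      simp at hy ⊢
      intro h3 _
      rw [h3]; exact hy
    · intro t ht
      simp at ht ⊢
      exact ht.2
  rw [key b, key (fun t => b (S t))]
  exact Finset.sum_congr rfl fun y _ => h x y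

theorem compat_equiv {α' β' : Type} (S : Equiv.Perm ι) (a : ι → α) (b : ι → β) (e : α ≃ α') (f : β ≃ β') :
    Compat S (fun t => e (a t)) (fun t => f (b t)) ↔ Compat S a b := by
  constructor
  · intro h x y
    have := h (e x) (f y)
    simpa using this
  · intro h x y
    have := h (e.symm x) (f.symm y)
    simpa only [Equiv.eq_symm_apply] using this

theorem compat_bool (S : Equiv.Perm ι) (a : ι → α) (c : ι → Bool) :
    Compat S a c ↔ Bal (univ.filter fun t => c t = true ∧ c (S t) = false)
      (univ.filter fun t => c t = false ∧ c (S t) = true) a := by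
  have d : ∀ (P Q : ι → Prop) [DecidablePred P], #{t | P t} = #{t | P t ∧ Q t} + #{t | P t ∧ ¬ Q t} := by
    intro P Q _
    rw [← Finset.filter_filter, ← Finset.filter_filter, Finset.card_filter_add_card_filter_not]
  have key : ∀ x,
      (#{t | a t = x ∧ c t = true} = #{t | a t = x ∧ c t = true ∧ c (S t) = true} +
        #{t ∈ univ.filter fun t => c t = true ∧ c (S t) = false | a t = x}) ∧
      (#{t | a t = x ∧ c (S t) = true} = #{t | a t = x ∧ c t = true ∧ c (S t) = true} +
        #{t ∈ univ.filter fun t => c t = false ∧ c (S t) = true | a t = x}) ∧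
      (#{t | a t = x ∧ c t = false} = #{t | a t = x ∧ c t = false ∧ c (S t) = false} +
        #{t ∈ univ.filter fun t => c t = false ∧ c (S t) = true | a t = x}) ∧
      (#{t | a t = x ∧ c (S t) = false} = #{t | a t = x ∧ c t = false ∧ c (S t) = false} +
        #{t ∈ univ.filter fun t => c t = true ∧ c (S t) = false | a t = x}) := by
    intro x
    refine ⟨?_, ?_, ?_, ?_⟩
    · rw [d (fun t => a t = x ∧ c t = true) (fun t => c (S t) = true), Finset.filter_filter]
      congr 2 <;> ext t <;> simp <;> tauto
    · rw [d (fun t => a t = x ∧ c (S t) = true) (fun t => c t = true), Finset.filter_filter]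
      congr 2 <;> ext t <;> simp <;> tauto
    · rw [d (fun t => a t = x ∧ c t = false) (fun t => c (S t) = false), Finset.filter_filter]
      congr 2 <;> ext t <;> simp <;> tauto
    · rw [d (fun t => a t = x ∧ c (S t) = false) (fun t => c t = false), Finset.filter_filter]
      congr 2 <;> ext t <;> simp <;> tauto
  constructor
  · intro h x
    have h1 : #{t | a t = x ∧ c t = true} = #{t | a t = x ∧ c (S t) = true} := by
      convert h x true
    obtain ⟨k1, k2, -, -⟩ := key x
    omega
  · intro h x y
    obtain ⟨k1, k2, k3, k4⟩ := key x
    have := h x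
    cases y
    · have : #{t | a t = x ∧ c t = false} = #{t | a t = x ∧ c (S t) = false} := by omega
      convert this
    · have : #{t | a t = x ∧ c t = true} = #{t | a t = x ∧ c (S t) = true} := by omega
      convert this

theorem sum_split [Nonempty ι] [Fintype γ] (F : (ι → γ) → ℝ) :
    ∑ a, F a = ∑ a, (if NC a then F a else 0) + ∑ z, F (fun _ => z) := by
  have h : ∑ z, F (fun _ => z) = ∑ a, (if NC a then 0 else F a) := by
    rw [← Finset.sum_filter_add_sum_filter_not univ (fun a : ι → γ => NC a) (fun a => if NC a then 0 else F a)]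
    have hz : ∑ a ∈ univ.filter (fun a : ι → γ => NC a), (if NC a then 0 else F a) = 0 :=
      Finset.sum_eq_zero (fun a ha => by simp at ha; simp [ha])
    rw [hz, zero_add]
    obtain ⟨t0⟩ := (inferInstance : Nonempty ι)
    refine Finset.sum_bij' (fun z _ => fun _ => z) (fun a _ => a t0) ?_ ?_ ?_ ?_ ?_
    · intro z _; simp [NC]
    · intro a _; simp
    · intro z _; rfl
    · intro a ha
      simp [NC] at ha
      funext t; exact ha _ _
    · intro z _; simp [NC]
  rw [h, ← Finset.sum_add_distrib]
  refine Finset.sum_congr rfl fun a _ => ?_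
  split_ifs <;> simp

theorem sum_NC [Nonempty ι] [Fintype γ] :
    ∑ a : ι → γ, (if NC a then (1:ℝ) else 0) =
      (Fintype.card γ : ℝ) ^ (Fintype.card ι) - Fintype.card γ := by
  have := sum_split (ι := ι) (γ := γ) (fun _ => 1)
  simp at this
  simp
  linarith

theorem cntA [Nonempty ι] (S : Equiv.Perm ι) (hS : Tr S) (c : ι → Bool) (hc : NC c) :
    ∃ k r, 1 ≤ k ∧ Fintype.card ι = 2 * k + r ∧ ∀ (γ : Type) [Fintype γ] (x : γ → ℝ),
      ∑ a : ι → γ, (if NC a ∧ Compat S a c then ∏ t, x (a t) else 0) =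
        (∑ z, x z) ^ r * Wt x k - ∑ z, x z ^ (2 * k + r) := by
  set U := univ.filter fun t => c t = true ∧ c (S t) = false with hU
  set V := univ.filter fun t => c t = false ∧ c (S t) = true with hV
  have hd : Disjoint U V := by
    rw [Finset.disjoint_left]
    intro t h1 h2
    simp [U] at h1
    simp [V] at h2
    simp_all
  have hcard : #U = #V := by
    have h1 : #{t | c t = true} = #{t | c (S t) = true} := by
      symm
      refine Finset.card_equiv S ?_
      intro t; simp
    have e1 : #{t | c t = true} = #{t | c t = true ∧ c (S t) = true} + #U := by
      rw [← Finset.card_filter_add_card_filter_not (s := univ.filter fun t => c t = true) (fun t => c (S t) = true),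
        Finset.filter_filter, Finset.filter_filter]
      simp [U]
    have e2 : #{t | c (S t) = true} = #{t | c t = true ∧ c (S t) = true} + #V := by
      rw [← Finset.card_filter_add_card_filter_not (s := univ.filter fun t => c (S t) = true) (fun t => c t = true),
        Finset.filter_filter, Finset.filter_filter]
      simp [V, and_comm]
    omega
  have hpos : 1 ≤ #U := by
    by_contra h0
    have hU0 : U = ∅ := by rw [← Finset.card_eq_zero]; omega
    have hV0 : V = ∅ := by rw [← Finset.card_eq_zero]; omega
    obtain ⟨t, s, hts⟩ := hc
    apply hts
    apply hS c
    intro t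
    have h1 : t ∉ U := by simp [hU0]
    have h2 : t ∉ V := by simp [hV0]
    simp [U] at h1
    simp [V] at h2
    cases h : c t <;> simp_all
  have hle : 2 * #U ≤ Fintype.card ι := by
    have := Finset.card_le_univ (U ∪ V)
    rw [Finset.card_union_of_disjoint hd] at this
    omega
  refine ⟨#U, Fintype.card ι - 2 * #U, hpos, by omega, ?_⟩
  intro γ _ x
  have h1 := bal_sum x #U (Fintype.card ι - 2 * #U) U V hd rfl hcard.symm (by omega)
  rw [sum_split] at h1
  rw [← h1]
  have e : 2 * #U + (Fintype.card ι - 2 * #U) = Fintype.card ι := by omega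
  rw [e]
  have h2 : ∀ z : γ, (if Bal U V (fun _ : ι => z) then ∏ _t : ι, x z else 0) = x z ^ Fintype.card ι := by
    intro z
    rw [if_pos]
    · simp
    · intro w
      by_cases h : z = w <;> simp [h, hcard]
  simp only [h2]
  rw [add_sub_cancel_right]
  refine Finset.sum_congr rfl fun a _ => ?_
  rw [compat_bool S a c, ite_and]

noncomputable def K (S : Equiv.Perm ι) (α β : Type) [Fintype α] [Fintype β] : ℝ :=
  ∑ a : ι → α, ∑ b : ι → β, if NC a ∧ NC b ∧ Compat S a b then 1 else 0

theorem NC_equiv {α' : Type} (a : ι → α) (e : α ≃ α') : NC (fun t => e (a t)) ↔ NC a := by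
  simp [NC]

theorem K_congr {α' β' : Type} [Fintype α] [Fintype β] [Fintype α'] [Fintype β']
    (S : Equiv.Perm ι) (e : α ≃ α') (f : β ≃ β') : K S α β = K S α' β' := by
  unfold K
  refine Fintype.sum_equiv (Equiv.arrowCongr (Equiv.refl ι) e) _ _ fun a => ?_
  refine Fintype.sum_equiv (Equiv.arrowCongr (Equiv.refl ι) f) _ _ fun b => ?_
  have h1 : (Equiv.arrowCongr (Equiv.refl ι) e) a = fun t => e (a t) := rfl
  have h2 : (Equiv.arrowCongr (Equiv.refl ι) f) b = fun t => f (b t) := rfl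
  rw [h1, h2, compat_equiv, NC_equiv, NC_equiv]

theorem K_symm [Fintype α] [Fintype β] (S : Equiv.Perm ι) : K S α β = K S⁻¹ β α := by
  unfold K
  rw [Finset.sum_comm]
  refine Finset.sum_congr rfl fun b _ => Finset.sum_congr rfl fun a _ => ?_
  rw [compat_symm S a b]
  simp only [and_left_comm]

theorem Tr_inv (S : Equiv.Perm ι) (h : Tr S) : Tr S⁻¹ := by
  intro c hc
  apply h
  intro t
  have := hc (S t)
  simpa using this.symm

theorem J_bound [Nonempty ι] (S : Equiv.Perm ι) (hS : Tr S) (m x y : ℕ) (hx : 1 ≤ x) (hy : y = x ∨ y = x + 1) :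
    ((2:ℝ) ^ Fintype.card ι - 2) ^ 2 * (∑ a : ι → Fin (m+3), ∑ c : ι → Bool,
      if NC a ∧ NC c ∧ Compat S a c then ∏ t, (if c t then (x:ℝ) else y) else 0) ≤
    (((m:ℝ) + 3) ^ Fintype.card ι - (m + 3)) *
     (((x:ℝ) + y) ^ Fintype.card ι - ((x:ℝ) ^ Fintype.card ι + (y:ℝ) ^ Fintype.card ι)) * K S Bool Bool := by
  set p := Fintype.card ι with hp
  have hp1 : p ≠ 0 := Fintype.card_ne_zero
  set w : Bool → ℝ := fun b => if b then (x:ℝ) else y with hw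
  have hw0 : ∀ c : ι → Bool, 0 ≤ ∏ t, w (c t) := fun c =>
    Finset.prod_nonneg fun t _ => by simp only [w]; split_ifs <;> positivity
  have h2p : (2:ℝ) ≤ 2 ^ p := by
    calc (2:ℝ) = 2 ^ 1 := by norm_num
      _ ≤ 2 ^ p := pow_le_pow_right₀ (by norm_num) (by omega)
  have hMp : ((m:ℝ)+3) ≤ (m+3) ^ p := by
    calc ((m:ℝ)+3) = (m+3) ^ 1 := by norm_num
      _ ≤ (m+3) ^ p := pow_le_pow_right₀ (by linarith [(Nat.cast_nonneg m : (0:ℝ) ≤ m)]) (by omega)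
  have hA : ∀ c : ι → Bool, NC c →
      5 * ((2:ℝ) ^ p - 2) * (∑ a : ι → Fin (m+3), if NC a ∧ Compat S a c then (1:ℝ) else 0) ≤
      4 * (((m:ℝ)+3) ^ p - (m+3)) * (∑ a : ι → Bool, if NC a ∧ Compat S a c then (1:ℝ) else 0) := by
    intro c hc
    obtain ⟨k, r, hk, hkr, h⟩ := cntA S hS c hc
    have h1 := h (Fin (m+3)) (fun _ => 1)
    have h2 := h Bool (fun _ => 1)
    have h3 := numA m k r hk
    rw [Wt_bool_one] at h2
    simp only [Finset.prod_const_one, one_pow, Finset.sum_const, Finset.card_univ, Fintype.card_fin, nsmul_eq_mul, mul_one, Fintype.card_bool] at h1 h2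
    push_cast at h1 h2
    rw [h1, h2, hp, hkr]
    exact h3
  have hB : ∀ a : ι → Bool, NC a →
      4 * ((2:ℝ) ^ p - 2) * (∑ c : ι → Bool, if NC c ∧ Compat S a c then ∏ t, w (c t) else 0) ≤
      5 * (((x:ℝ) + y) ^ p - ((x:ℝ) ^ p + (y:ℝ) ^ p)) * (∑ c : ι → Bool, if NC c ∧ Compat S a c then (1:ℝ) else 0) := by
    intro a ha
    obtain ⟨k, r, hk, hkr, h⟩ := cntA S⁻¹ (Tr_inv S hS) a ha
    have h1 := h Bool w
    have h2 := h Bool (fun _ => 1)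
    have h3 := numB x y k r hx hy hk
    rw [Wt_bool_one] at h2
    simp only [Finset.prod_const_one, one_pow, Finset.sum_const, Finset.card_univ, Fintype.card_fin, nsmul_eq_mul, mul_one, Fintype.card_bool] at h2
    push_cast at h2
    simp only [compat_symm S a]
    rw [h1, h2, hp, hkr]
    simpa [w] using h3
  have e1 : 5 * ((2:ℝ) ^ p - 2) * (∑ a : ι → Fin (m+3), ∑ c : ι → Bool,
      if NC a ∧ NC c ∧ Compat S a c then ∏ t, w (c t) else 0) ≤
      4 * (((m:ℝ)+3) ^ p - (m+3)) * (∑ a : ι → Bool, ∑ c : ι → Bool,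
      if NC a ∧ NC c ∧ Compat S a c then ∏ t, w (c t) else 0) := by
    rw [Finset.sum_comm, Finset.mul_sum, Finset.sum_comm (s := (univ : Finset (ι → Bool))), Finset.mul_sum]
    refine Finset.sum_le_sum fun c _ => ?_
    by_cases hc : NC c
    · have := mul_le_mul_of_nonneg_left (hA c hc) (hw0 c)
      have q : ∀ {γ : Type} [Fintype γ], (∑ a : ι → γ, if NC a ∧ NC c ∧ Compat S a c then ∏ t, w (c t) else 0)
          = (∏ t, w (c t)) * (∑ a : ι → γ, if NC a ∧ Compat S a c then (1:ℝ) else 0) := by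
        intro γ _
        rw [Finset.mul_sum]
        refine Finset.sum_congr rfl fun a _ => ?_
        simp [hc]
      rw [q, q]
      linarith
    · simp [hc]
  have e2 : 4 * ((2:ℝ) ^ p - 2) * (∑ a : ι → Bool, ∑ c : ι → Bool,
      if NC a ∧ NC c ∧ Compat S a c then ∏ t, w (c t) else 0) ≤
      5 * (((x:ℝ) + y) ^ p - ((x:ℝ) ^ p + (y:ℝ) ^ p)) * K S Bool Bool := by
    unfold K
    rw [Finset.mul_sum, Finset.mul_sum]
    refine Finset.sum_le_sum fun a _ => ?_
    by_cases ha : NC a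
    · have := hB a ha
      simpa [ha] using this
    · simp [ha]
  set J := (∑ a : ι → Fin (m+3), ∑ c : ι → Bool,
      if NC a ∧ NC c ∧ Compat S a c then ∏ t, w (c t) else 0) with hJ
  set J2 := (∑ a : ι → Bool, ∑ c : ι → Bool,
      if NC a ∧ NC c ∧ Compat S a c then ∏ t, w (c t) else 0)
  have e3 := mul_le_mul_of_nonneg_left e1 (show 0 ≤ 4 * ((2:ℝ)^p - 2) by linarith)
  have e4 := mul_le_mul_of_nonneg_left e2 (show 0 ≤ 4 * (((m:ℝ)+3)^p - (m+3)) by linarith)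
  change ((2:ℝ) ^ p - 2) ^ 2 * J ≤ _
  nlinarith

end cmp
section ind
variable {ι α β γ : Type} [Fintype ι] [DecidableEq ι]

theorem step_card {A B : Type} [Fintype A] [Fintype B] (S : Equiv.Perm ι) (a : ι → α) :
    (∑ b : ι → A ⊕ B, if NC b ∧ Compat S a b then (1:ℝ) else 0) ≤
    (∑ b : ι → A, if NC b ∧ Compat S a b then (1:ℝ) else 0) +
    (∑ b : ι → B, if NC b ∧ Compat S a b then (1:ℝ) else 0) +
    ∑ c : ι → Bool, if NC c ∧ Compat S a c then
      ∏ t, (if c t then (Fintype.card A : ℝ) else Fintype.card B) else 0 := by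
  have hsub : univ.filter (fun b : ι → A ⊕ B => NC b ∧ Compat S a b) ⊆
      ((univ.filter (fun b : ι → A => NC b ∧ Compat S a b)).image (fun b t => (Sum.inl (b t) : A ⊕ B)) ∪
       (univ.filter (fun b : ι → B => NC b ∧ Compat S a b)).image (fun b t => (Sum.inr (b t) : A ⊕ B))) ∪
      (univ.filter (fun c : ι → Bool => NC c ∧ Compat S a c)).biUnion
        (fun c => Fintype.piFinset (fun t => univ.filter (fun z : A ⊕ B => z.isLeft = c t))) := by
    intro b hb
    simp only [mem_filter, mem_univ, true_and] at hb
    obtain ⟨hnc, hcomp⟩ := hb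
    by_cases h : NC (fun t => (b t).isLeft)
    · apply Finset.mem_union_right
      rw [Finset.mem_biUnion]
      refine ⟨fun t => (b t).isLeft, ?_, ?_⟩
      · simp only [mem_filter, mem_univ, true_and]
        exact ⟨h, compat_map S a b Sum.isLeft hcomp⟩
      · simp [Fintype.mem_piFinset]
    · apply Finset.mem_union_left
      simp only [NC, not_exists, not_not] at h
      obtain ⟨t0, s0, hts⟩ := hnc
      cases hb0 : (b t0).isLeft with
      | true =>
        apply Finset.mem_union_left
        have hl : ∀ t, (b t).isLeft = true := fun t => by rw [h t t0, hb0]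
        choose g hg using fun t => Sum.isLeft_iff.1 (hl t)
        have hbg : b = fun t => Sum.inl (g t) := funext hg
        subst hbg
        rw [Finset.mem_image]
        refine ⟨g, ?_, rfl⟩
        simp only [mem_filter, mem_univ, true_and]
        refine ⟨⟨t0, s0, fun e => hts (by simp [e])⟩, ?_⟩
        intro x y
        have := hcomp x (Sum.inl y)
        simpa using this
      | false =>
        apply Finset.mem_union_right
        have hl : ∀ t, (b t).isRight = true := fun t => by
          have := h t t0
          rw [hb0] at this
          simpa using this
        choose g hg using fun t => Sum.isRight_iff.1 (hl t)
        have hbg : b = fun t => Sum.inr (g t) := funext hg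
        subst hbg
        rw [Finset.mem_image]
        refine ⟨g, ?_, rfl⟩
        simp only [mem_filter, mem_univ, true_and]
        refine ⟨⟨t0, s0, fun e => hts (by simp [e])⟩, ?_⟩
        intro x y
        have := hcomp x (Sum.inr y)
        simpa using this
  have hcard := (Finset.card_le_card hsub).trans (Finset.card_union_le _ _)
  have h1 := hcard.trans (Nat.add_le_add
    ((Finset.card_union_le _ _).trans (Nat.add_le_add Finset.card_image_le Finset.card_image_le))
    Finset.card_biUnion_le)
  have hc : ∀ c : ι → Bool, (#(Fintype.piFinset (fun t => univ.filter (fun z : A ⊕ B => z.isLeft = c t))) : ℝ)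
      = ∏ t, (if c t then (Fintype.card A : ℝ) else Fintype.card B) := by
    intro c
    rw [Fintype.card_piFinset]
    push_cast
    refine Finset.prod_congr rfl fun t _ => ?_
    cases c t
    · have : univ.filter (fun z : A ⊕ B => z.isLeft = false) = univ.image Sum.inr := by
        ext z; cases z <;> simp
      rw [this, Finset.card_image_of_injective _ Sum.inr_injective]
      simp
    · have : univ.filter (fun z : A ⊕ B => z.isLeft = true) = univ.image Sum.inl := by
        ext z; cases z <;> simp
      rw [this, Finset.card_image_of_injective _ Sum.inl_injective]
      simp
  have h2 : ((#(univ.filter (fun b : ι → A ⊕ B => NC b ∧ Compat S a b)) : ℕ) : ℝ) ≤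
    ((#(univ.filter (fun b : ι → A => NC b ∧ Compat S a b)) + #(univ.filter (fun b : ι → B => NC b ∧ Compat S a b))
      + ∑ c ∈ univ.filter (fun c : ι → Bool => NC c ∧ Compat S a c), #(Fintype.piFinset (fun t => univ.filter (fun z : A ⊕ B => z.isLeft = c t))) : ℕ) : ℝ) := by
    exact_mod_cast h1
  push_cast at h2
  simp only [hc] at h2
  rw [Finset.sum_boole, Finset.sum_boole, Finset.sum_boole, ← Finset.sum_filter]
  exact h2

theorem K_step {A B : Type} [Fintype A] [Fintype B] [Fintype α] (S : Equiv.Perm ι) :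
    K S α (A ⊕ B) ≤ K S α A + K S α B +
      ∑ a : ι → α, ∑ c : ι → Bool,
      if NC a ∧ NC c ∧ Compat S a c then
        ∏ t, (if c t then (Fintype.card A : ℝ) else Fintype.card B) else 0 := by
  unfold K
  rw [← Finset.sum_add_distrib, ← Finset.sum_add_distrib]
  refine Finset.sum_le_sum fun a _ => ?_
  by_cases ha : NC a
  · simpa [ha] using step_card (A := A) (B := B) S a
  · simp [ha]

theorem main3 [Nonempty ι] (S : Equiv.Perm ι) (hS : Tr S) (m N : ℕ) (hN : 1 ≤ N) :
    ((2:ℝ) ^ Fintype.card ι - 2) ^ 2 * K S (Fin (m+3)) (Fin N) ≤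
    (((m:ℝ) + 3) ^ Fintype.card ι - (m + 3)) * ((N:ℝ) ^ Fintype.card ι - N) * K S Bool Bool := by
  induction N using Nat.strong_induction_on with
  | _ N ih =>
    rcases Nat.lt_or_ge N 2 with h | h
    · obtain rfl : N = 1 := by omega
      have : K S (Fin (m+3)) (Fin 1) = 0 := by
        unfold K
        refine Finset.sum_eq_zero fun a _ => Finset.sum_eq_zero fun b _ => ?_
        rw [if_neg]
        rintro ⟨-, ⟨t, s, hts⟩, -⟩
        exact hts (Subsingleton.elim _ _)
      rw [this]; simp
    · obtain ⟨x, y, hx, hy, rfl⟩ : ∃ x y, 1 ≤ x ∧ (y = x ∨ y = x + 1) ∧ N = x + y :=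
        ⟨N / 2, N - N / 2, by omega, by omega, by omega⟩
      have i1 := ih x (by omega) hx
      have i2 := ih y (by omega) (by omega)
      have hk := K_step (A := Fin x) (B := Fin y) (α := Fin (m+3)) S
      rw [K_congr S (Equiv.refl (Fin (m+3))) (finSumFinEquiv (m := x) (n := y))] at hk
      simp only [Fintype.card_fin] at hk
      have hj := J_bound S hS m x y hx hy
      have := mul_le_mul_of_nonneg_left hk (sq_nonneg ((2:ℝ) ^ Fintype.card ι - 2))
      push_cast
      linarith

theorem main_bound [Nonempty ι] (S : Equiv.Perm ι) (hS : Tr S) (M N : ℕ) (hM : 2 ≤ M) (hN : 2 ≤ N) :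
    ((2:ℝ) ^ Fintype.card ι - 2) ^ 2 * K S (Fin M) (Fin N) ≤
    ((M:ℝ) ^ Fintype.card ι - M) * ((N:ℝ) ^ Fintype.card ι - N) * K S Bool Bool := by
  rcases Nat.lt_or_ge M 3 with h | h
  · rcases Nat.lt_or_ge N 3 with h' | h'
    · obtain rfl : M = 2 := by omega
      obtain rfl : N = 2 := by omega
      rw [K_congr S finTwoEquiv finTwoEquiv]
      push_cast
      apply le_of_eq; ring
    · obtain ⟨n, rfl⟩ : ∃ n, N = n + 3 := ⟨N - 3, by omega⟩
      have := main3 S⁻¹ (Tr_inv S hS) n M (by omega)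
      rw [K_symm S, K_symm S (α := Bool)]
      push_cast
      linarith
  · obtain ⟨n, rfl⟩ : ∃ n, M = n + 3 := ⟨M - 3, by omega⟩
    have := main3 S hS n N (by omega)
    push_cast
    linarith

theorem total_bound [Nonempty ι] [Fintype α] [Fintype β] (S : Equiv.Perm ι) :
    (∑ a : ι → α, ∑ b : ι → β, if Compat S a b then (1:ℝ) else 0) ≤
      (Fintype.card α : ℝ) ^ Fintype.card ι * (Fintype.card β : ℝ) ^ Fintype.card ι -
      ((Fintype.card α : ℝ) ^ Fintype.card ι - Fintype.card α) *
      ((Fintype.card β : ℝ) ^ Fintype.card ι - Fintype.card β) + K S α β := by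
  rw [← sum_NC (ι := ι) (γ := α), ← sum_NC (ι := ι) (γ := β)]
  have h1 : (Fintype.card α : ℝ) ^ Fintype.card ι * (Fintype.card β : ℝ) ^ Fintype.card ι =
      ∑ a : ι → α, ∑ b : ι → β, (1:ℝ) := by simp
  rw [h1, Finset.sum_mul_sum]
  unfold K
  rw [← Finset.sum_sub_distrib, ← Finset.sum_add_distrib]
  refine Finset.sum_le_sum fun a _ => ?_
  rw [← Finset.sum_sub_distrib, ← Finset.sum_add_distrib]
  refine Finset.sum_le_sum fun b _ => ?_
  by_cases ha : NC a <;> by_cases hb : NC b <;> by_cases hc : Compat S a b <;> simp [ha, hb, hc]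

theorem K_nonneg [Fintype α] [Fintype β] (S : Equiv.Perm ι) : 0 ≤ K S α β :=
  Finset.sum_nonneg fun _ _ => Finset.sum_nonneg fun _ _ => by split_ifs <;> norm_num

end ind

section fin
variable {p : ℕ}

theorem cyc_pred (y : Fin p) : cycPred p (cyc p y) = y := by
  apply Fin.ext
  have hy := y.2
  simp only [cyc, cycPred]
  rcases Nat.lt_or_ge (y.1 + 1) p with h | h
  · rw [Nat.mod_eq_of_lt h]
    have : y.1 + 1 + p - 1 = y.1 + p := by omega
    rw [this, Nat.add_mod_right, Nat.mod_eq_of_lt hy]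
  · have h' : y.1 + 1 = p := by omega
    rw [h', Nat.mod_self, Nat.mod_eq_of_lt (by omega)]
    omega

theorem pred_cyc (y : Fin p) : cyc p (cycPred p y) = y := by
  apply Fin.ext
  have hy := y.2
  simp only [cyc, cycPred]
  rcases Nat.eq_zero_or_pos y.1 with h | h
  · rw [h, Nat.mod_eq_of_lt (show 0 + p - 1 < p by omega)]
    have : 0 + p - 1 + 1 = p := by omega
    rw [this, Nat.mod_self]
  · have : y.1 + p - 1 = (y.1 - 1) + p := by omega
    rw [this, Nat.add_mod_right, Nat.mod_eq_of_lt (show y.1 - 1 < p by omega)]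
    rw [Nat.mod_eq_of_lt (by omega)]
    omega

def Sp (p : ℕ) : Equiv.Perm (Fin p) := ⟨cyc p, cycPred p, cyc_pred, pred_cyc⟩

theorem Sp_apply (t : Fin p) : Sp p t = cyc p t := rfl

theorem Sp_tr (hp : 1 ≤ p) : Tr (Sp p) := by
  intro c hc
  have h : ∀ n (hn : n < p), c ⟨n, hn⟩ = c ⟨0, by omega⟩ := by
    intro n
    induction n with
    | zero => intro _; rfl
    | succ n ih =>
      intro hn
      rw [← ih (by omega), ← hc ⟨n, by omega⟩]
      congr 1
      apply Fin.ext
      simp [Sp_apply, cyc, Nat.mod_eq_of_lt hn]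
  intro t s
  rw [h t.1 t.2, h s.1 s.2]

def chi (t0 : Fin p) (π : Finpartition (univ : Finset (Fin p))) : Fin p → Bool :=
  fun t => decide (t ∈ π.part t0)

theorem parts_two (t0 : Fin p) (π : Finpartition (univ : Finset (Fin p))) (h : π.parts.card = 2) :
    π.parts = {π.part t0, (π.part t0)ᶜ} ∧ (π.part t0)ᶜ.Nonempty := by
  have hm : π.part t0 ∈ π.parts := π.part_mem.2 (mem_univ _)
  obtain ⟨B, hB⟩ : ∃ B, π.parts.erase (π.part t0) = {B} := by
    rw [← Finset.card_eq_one, Finset.card_erase_of_mem hm, h]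
  have hparts : π.parts = {π.part t0, B} := by
    rw [← Finset.insert_erase hm, hB]
  have hBm : B ∈ π.parts := by rw [hparts]; simp
  have hne : B ≠ π.part t0 := by
    have : B ∈ π.parts.erase (π.part t0) := by rw [hB]; simp
    exact (Finset.mem_erase.1 this).1
  have hdis : Disjoint B (π.part t0) := π.disjoint hBm hm hne
  have hBc : B = (π.part t0)ᶜ := by
    ext t
    rw [Finset.mem_compl]
    constructor
    · intro h1 h2
      exact Finset.disjoint_left.1 hdis h1 h2
    · intro h1
      obtain ⟨C, hC, htC⟩ := π.exists_mem (mem_univ t)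
      rw [hparts] at hC
      simp only [mem_insert, mem_singleton] at hC
      rcases hC with rfl | rfl
      · exact absurd htC h1
      · exact htC
  rw [← hBc]
  exact ⟨hparts, π.nonempty_of_mem_parts hBm⟩

theorem chi_t0 (t0 : Fin p) (π : Finpartition (univ : Finset (Fin p))) : chi t0 π t0 = true := by
  simp [chi]

theorem chi_NC (t0 : Fin p) (π : Finpartition (univ : Finset (Fin p))) (h : π.parts.card = 2) :
    NC (chi t0 π) := by
  obtain ⟨-, s, hs⟩ := parts_two t0 π h
  refine ⟨t0, s, ?_⟩
  rw [chi_t0]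
  rw [Finset.mem_compl] at hs
  simp [chi, hs]

theorem chi_inj (t0 : Fin p) (π σ : Finpartition (univ : Finset (Fin p))) (h : π.parts.card = 2)
    (h' : σ.parts.card = 2) (e : chi t0 π = chi t0 σ) : π = σ := by
  have : π.part t0 = σ.part t0 := by
    ext t
    have := congrFun e t
    simpa [chi] using this
  apply Finpartition.ext
  rw [(parts_two t0 π h).1, (parts_two t0 σ h').1, this]

theorem chi_surj (t0 : Fin p) (a : Fin p → Bool) (ha : NC a) (h0 : a t0 = true) :
    ∃ π : Finpartition (univ : Finset (Fin p)), π.parts.card = 2 ∧ chi t0 π = a := by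
  set A : Finset (Fin p) := univ.filter (fun t => a t = true) with hA
  have hAne : A.Nonempty := ⟨t0, by simp [A, h0]⟩
  have hAc : Aᶜ.Nonempty := by
    by_contra hh
    rw [Finset.not_nonempty_iff_eq_empty] at hh
    have : ∀ t, a t = true := by
      intro t
      have : t ∉ Aᶜ := by rw [hh]; simp
      simpa [A] using this
    obtain ⟨t, s, hts⟩ := ha
    exact hts (by rw [this, this])
  have hne : A ≠ Aᶜ := by
    intro e
    have h1 : t0 ∈ A := by simp [A, h0]
    have h2 := h1
    rw [e, Finset.mem_compl] at h2
    exact h2 h1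
  let π : Finpartition (univ : Finset (Fin p)) := Finpartition.ofExistsUnique {A, Aᶜ}
    (fun q _ => Finset.subset_univ q)
    (by
      intro t _
      by_cases ht : t ∈ A
      · refine ⟨A, ⟨by simp, ht⟩, ?_⟩
        rintro q ⟨hq, htq⟩
        simp only [mem_insert, mem_singleton] at hq
        rcases hq with rfl | rfl
        · rfl
        · exact absurd ht (Finset.mem_compl.1 htq)
      · refine ⟨Aᶜ, ⟨by simp, by simpa using ht⟩, ?_⟩
        rintro q ⟨hq, htq⟩
        simp only [mem_insert, mem_singleton] at hq
        rcases hq with rfl | rfl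
        · exact absurd htq ht
        · rfl)
    (by
      intro h
      simp only [mem_insert, mem_singleton] at h
      rcases h with h | h
      · rw [← h] at hAne; simp at hAne
      · rw [← h] at hAc; simp at hAc)
  have hparts : π.parts = {A, Aᶜ} := rfl
  refine ⟨π, ?_, ?_⟩
  · rw [hparts, Finset.card_pair hne]
  · have : π.part t0 = A := π.part_eq_of_mem (by rw [hparts]; simp) (by simp [A, h0])
    funext t
    simp [chi, this, A]

theorem sum_two (t0 : Fin p) (G : (Fin p → Bool) → ℝ) (hG : ∀ a, G (fun t => !(a t)) = G a) :
    ∑ a, (if NC a then G a else 0) =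
      2 * ∑ π ∈ univ.filter (fun π : Finpartition (univ : Finset (Fin p)) => π.parts.card = 2), G (chi t0 π) := by
  have e1 : ∑ π ∈ univ.filter (fun π : Finpartition (univ : Finset (Fin p)) => π.parts.card = 2), G (chi t0 π)
      = ∑ a ∈ univ.filter (fun a : Fin p → Bool => NC a ∧ a t0 = true), G a := by
    refine Finset.sum_bij (fun π _ => chi t0 π) ?_ ?_ ?_ ?_
    · intro π hπ
      simp only [mem_filter, mem_univ, true_and] at hπ ⊢
      exact ⟨chi_NC t0 π hπ, chi_t0 t0 π⟩
    · intro π hπ σ hσ e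
      simp only [mem_filter, mem_univ, true_and] at hπ hσ
      exact chi_inj t0 π σ hπ hσ e
    · intro a ha
      simp only [mem_filter, mem_univ, true_and] at ha
      obtain ⟨π, h1, h2⟩ := chi_surj t0 a ha.1 ha.2
      exact ⟨π, by simp [h1], h2⟩
    · intro π _; rfl
  have e2 : ∑ a ∈ univ.filter (fun a : Fin p → Bool => NC a ∧ ¬ a t0 = true), G a
      = ∑ a ∈ univ.filter (fun a : Fin p → Bool => NC a ∧ a t0 = true), G a := by
    refine Finset.sum_bij' (fun a _ => fun t => !(a t)) (fun a _ => fun t => !(a t)) ?_ ?_ ?_ ?_ ?_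
    · intro a ha
      simp only [mem_filter, mem_univ, true_and] at ha ⊢
      refine ⟨?_, by simpa using ha.2⟩
      obtain ⟨t, s, h⟩ := ha.1
      exact ⟨t, s, by simpa using h⟩
    · intro a ha
      simp only [mem_filter, mem_univ, true_and] at ha ⊢
      refine ⟨?_, by simpa using ha.2⟩
      obtain ⟨t, s, h⟩ := ha.1
      exact ⟨t, s, by simpa using h⟩
    · intro a _; simp
    · intro a _; simp
    · intro a _; exact (hG a).symm
  rw [← Finset.sum_filter, ← Finset.sum_filter_add_sum_filter_not _ (fun a : Fin p → Bool => a t0 = true),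
    Finset.filter_filter, Finset.filter_filter, e2, e1]
  ring

theorem parts_blk (t0 : Fin p) (π : Finpartition (univ : Finset (Fin p))) (h : π.parts.card = 2)
    (β : Finset (Fin p)) : β ∈ π.parts ↔ ∃ x, β = univ.filter (fun t => chi t0 π t = x) := by
  rw [(parts_two t0 π h).1]
  have h1 : univ.filter (fun t => chi t0 π t = true) = π.part t0 := by ext t; simp [chi]
  have h2 : univ.filter (fun t => chi t0 π t = false) = (π.part t0)ᶜ := by ext t; simp [chi]
  rw [Bool.exists_bool, h1, h2, Finset.mem_insert, Finset.mem_singleton, or_comm]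

theorem tri_iff (t0 : Fin p) (π σ : Finpartition (univ : Finset (Fin p))) (h : π.parts.card = 2)
    (h' : σ.parts.card = 2) : tri p π σ ↔ Compat (Sp p) (chi t0 σ) (chi t0 π) := by
  have c1 : ∀ x y, (univ.filter (fun t => chi t0 π t = y) ∩ univ.filter (fun t => chi t0 σ t = x)).card =
      #{t | chi t0 σ t = x ∧ chi t0 π t = y} := by
    intro x y
    congr 1
    ext t
    simp [and_comm]
  have c2 : ∀ x y, ((univ.filter (fun t => chi t0 π t = y)).image (cycPred p) ∩
      univ.filter (fun t => chi t0 σ t = x)).card = #{t | chi t0 σ t = x ∧ chi t0 π (Sp p t) = y} := by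
    intro x y
    congr 1
    ext t
    simp only [mem_inter, mem_image, mem_filter, mem_univ, true_and]
    constructor
    · rintro ⟨⟨s, hs, rfl⟩, ht⟩
      refine ⟨ht, ?_⟩
      rw [Sp_apply, pred_cyc]
      exact hs
    · rintro ⟨ht, hs⟩
      exact ⟨⟨_, hs, cyc_pred t⟩, ht⟩
  constructor
  · intro hh x y
    have := hh _ ((parts_blk t0 π h _).2 ⟨y, rfl⟩) _ ((parts_blk t0 σ h' _).2 ⟨x, rfl⟩)
    rw [c1, c2] at this
    convert this
  · intro hh β hβ γ hγ
    obtain ⟨y, rfl⟩ := (parts_blk t0 π h _).1 hβ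
    obtain ⟨x, rfl⟩ := (parts_blk t0 σ h' _).1 hγ
    rw [c1, c2]
    convert hh x y

theorem eps_eq (hp : 1 ≤ p) :
    4 * ((Finset.univ.filter
    (fun πσ : Finpartition (Finset.univ : Finset (Fin p)) ×
        Finpartition (Finset.univ : Finset (Fin p)) =>
      πσ.1.parts.card = 2 ∧ πσ.2.parts.card = 2 ∧ tri p πσ.1 πσ.2)).card : ℝ) = K (Sp p) Bool Bool := by
  have t0 : Fin p := ⟨0, by omega⟩
  have hflip : ∀ (a b : Fin p → Bool), (Compat (Sp p) (fun t => !(a t)) b ↔ Compat (Sp p) a b) ∧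
      (Compat (Sp p) a (fun t => !(b t)) ↔ Compat (Sp p) a b) := by
    intro a b
    exact ⟨compat_equiv (Sp p) a b Equiv.boolNot (Equiv.refl Bool),
      compat_equiv (Sp p) a b (Equiv.refl Bool) Equiv.boolNot⟩
  have hK : K (Sp p) Bool Bool = ∑ a : Fin p → Bool, (if NC a then
      (∑ b : Fin p → Bool, if NC b then (if Compat (Sp p) a b then (1:ℝ) else 0) else 0) else 0) := by
    unfold K
    refine Finset.sum_congr rfl fun a _ => ?_
    by_cases ha : NC a
    · simp only [ha, true_and, if_true]
      refine Finset.sum_congr rfl fun b _ => ?_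
      rw [ite_and]
    · simp [ha]
  rw [hK, sum_two t0]
  · have h2 := fun a : Fin p → Bool => sum_two t0 (fun b => if Compat (Sp p) a b then (1:ℝ) else 0)
      (fun b => by simp only [(hflip a b).2])
    simp only [h2]
    rw [← Finset.mul_sum, Finset.sum_comm, ← Finset.sum_product', ← mul_assoc]
    rw [Finset.sum_boole]
    norm_num
    congr 1
    ext ⟨π, σ⟩
    simp only [mem_filter, mem_univ, true_and, mem_product]
    constructor
    · rintro ⟨h1, h2, h3⟩
      exact ⟨⟨h1, h2⟩, (tri_iff t0 π σ h1 h2).1 h3⟩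
    · rintro ⟨⟨h1, h2⟩, h3⟩
      exact ⟨h1, h2, (tri_iff t0 π σ h1 h2).2 h3⟩
  · intro a
    simp only [(hflip a _).1]

theorem Spart_eq (hp : 1 ≤ p) : 2 * (Spart p 2 : ℝ) = 2 ^ p - 2 := by
  have t0 : Fin p := ⟨0, by omega⟩
  have : Nonempty (Fin p) := ⟨t0⟩
  have h1 := sum_two t0 (fun _ => (1:ℝ)) (fun _ => rfl)
  have h2 := sum_NC (ι := Fin p) (γ := Bool)
  rw [h2] at h1
  simp only [Fintype.card_bool, Fintype.card_fin, Finset.sum_const, nsmul_eq_mul, mul_one] at h1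
  push_cast at h1
  rw [h1]
  unfold Spart
  rfl

theorem delta_eq (M N : ℕ) [NeZero M] [NeZero N] :
    delta M N p = (∑ a : Fin p → ZMod M, ∑ b : Fin p → ZMod N, if Compat (Sp p) a b then (1:ℝ) else 0) /
      ((M : ℝ) * N) ^ p := by
  unfold delta
  congr 1
  rw [← Finset.sum_product', Finset.sum_boole, Nat.card_eq_fintype_card, Fintype.card_subtype]
  congr 2
  ext ⟨a, b⟩
  simp only [mem_filter, mem_univ, true_and, univ_product_univ]
  rw [Multiset.ext]
  simp only [Multiset.count_map]
  constructor
  · intro h x y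
    have := h (x, y)
    rw [Finset.card_def, Finset.card_def, Finset.filter_val, Finset.filter_val]
    convert this using 3 <;> simp [Prod.ext_iff, eq_comm, Sp_apply]
  · rintro h ⟨x, y⟩
    have := h x y
    rw [Finset.card_def, Finset.card_def, Finset.filter_val, Finset.filter_val] at this
    convert this using 3 <;> simp [Prod.ext_iff, eq_comm, Sp_apply]

theorem final (M N p : ℕ) (hM : 2 ≤ M) (hN : 2 ≤ N) (hp : 1 ≤ p) :
    delta M N p ≤ 1 - (1 - 1 / (M : ℝ) ^ (p - 1)) * (1 - 1 / (N : ℝ) ^ (p - 1)) *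
      (1 - eps p 2 2) := by
  have : NeZero M := ⟨by omega⟩
  have : NeZero N := ⟨by omega⟩
  have : Nonempty (Fin p) := ⟨⟨0, by omega⟩⟩
  have hM0 : (0:ℝ) < M := by exact_mod_cast (by omega : 0 < M)
  have hN0 : (0:ℝ) < N := by exact_mod_cast (by omega : 0 < N)
  have ht := total_bound (α := ZMod M) (β := ZMod N) (Sp p)
  have hm := main_bound (Sp p) (Sp_tr hp) M N hM hN
  have hk := K_congr (Sp p) (ZMod.finEquiv M).toEquiv (ZMod.finEquiv N).toEquiv
  rw [hk, ← eps_eq hp] at hm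
  have hs := Spart_eq hp
  rw [delta_eq, div_le_iff₀ (by positivity)]
  simp only [ZMod.card, Fintype.card_fin] at ht hm
  refine ht.trans ?_
  rw [← hs] at hm
  unfold eps
  set E := ((Finset.univ.filter
    (fun πσ : Finpartition (Finset.univ : Finset (Fin p)) ×
        Finpartition (Finset.univ : Finset (Fin p)) =>
      πσ.1.parts.card = 2 ∧ πσ.2.parts.card = 2 ∧ tri p πσ.1 πσ.2)).card : ℝ) with hE
  obtain ⟨q, rfl⟩ : ∃ q, p = q + 1 := ⟨p - 1, by omega⟩
  have f : ∀ X : ℝ, 0 < X → (1 - 1 / X ^ (q + 1 - 1)) * X ^ (q+1) = X ^ (q+1) - X := by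
    intro X hX
    have : X ^ q ≠ 0 := by positivity
    simp only [Nat.add_sub_cancel, pow_succ]
    field_simp
  have fM := f M hM0
  have fN := f N hN0
  set A := (1 - 1 / (M:ℝ) ^ (q + 1 - 1))
  set B := (1 - 1 / (N:ℝ) ^ (q + 1 - 1))
  rw [mul_pow]
  rw [← fM, ← fN] at hm ⊢
  rcases Nat.eq_zero_or_pos q with hq | hq
  · subst hq
    have hK0 : K (Sp (0+1)) (ZMod M) (ZMod N) = 0 := by
      unfold K
      refine Finset.sum_eq_zero fun a _ => Finset.sum_eq_zero fun b _ => ?_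
      rw [if_neg]
      rintro ⟨-, ⟨t, s, hts⟩, -⟩
      exact hts (congrArg b (Fin.ext (by omega)))
    have hA : A = 0 := by simp [A]
    rw [hK0, hA]
    simp
  · have h4 : (4:ℝ) ≤ 2 ^ (q+1) := by
      calc (4:ℝ) = 2 ^ 2 := by norm_num
        _ ≤ 2 ^ (q+1) := pow_le_pow_right₀ (by norm_num) (by omega)
    have hS : (0:ℝ) < Spart (q+1) 2 := by linarith
    have hKle : K (Sp (q+1)) (ZMod M) (ZMod N) ≤
        A * (M:ℝ) ^ (q+1) * (B * (N:ℝ) ^ (q+1)) * (E / ((Spart (q+1) 2 : ℝ) * Spart (q+1) 2)) := by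
      rw [mul_div_assoc', le_div_iff₀ (by positivity)]
      nlinarith
    linarith

end fin

end S13

theorem stmt13 (M N p : ℕ) (hM : 2 ≤ M) (hN : 2 ≤ N) (hp : 1 ≤ p) :
    delta M N p ≤ 1 - (1 - 1 / (M : ℝ) ^ (p - 1)) * (1 - 1 / (N : ℝ) ^ (p - 1)) *
      (1 - eps p 2 2) := by
  exact S13.final M N p hM hN hp
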